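/- arXiv:1405.5146 — 3 statements merged into one kernel-verified Lean document; each statement's English description precedes it below -/
import Mathlib

section
/- Suppose W : [0,∞) → (-∞,∞] is lower-semicontinuous, w(x) = W(|x|) is locally integrable on ℝ^N, and W(r) → 0 as r → ∞. If there exists a probability measure μ̄ ∈ P(ℝ^N) with E(μ̄) ≤ 0, then the energy E(μ) = ∫∫ w(x−y) dμ(x) dμ(y) admits a global minimizer in P(ℝ^N): there exists μ_0 ∈ P(ℝ^N) with E(μ_0) = inf_{μ ∈ P(ℝ^N)} E(μ). -/
open MeasureTheory Metric Filter ENNReal Topology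

/-- The positive part of an extended real number, as an element of `ℝ≥0∞`. -/
noncomputable def EReal.posPart (a : EReal) : ℝ≥0∞ :=
  if a = ⊤ then ⊤ else ENNReal.ofReal a.toReal

/-- The absolute value of an extended real number, as an element of `ℝ≥0∞`. -/
noncomputable def EReal.eabs (a : EReal) : ℝ≥0∞ := a.posPart + (-a).posPart

/-- The integral of an `EReal`-valued function: the integral of the positive part minus
the integral of the negative part. -/
noncomputable def eintegral {α : Type*} [MeasurableSpace α] (μ : Measure α)
    (f : α → EReal) : EReal :=
  ((∫⁻ x, (f x).posPart ∂μ : ℝ≥0∞) : EReal) - ((∫⁻ x, (-(f x)).posPart ∂μ : ℝ≥0∞) : EReal)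

/-- The nonlocal-interaction energy `E(μ) = ∫∫ W(|x-y|) dμ(x) dμ(y)`. -/
noncomputable def energy {N : ℕ} (W : ℝ → EReal)
    (μ : Measure (EuclideanSpace ℝ (Fin N))) : EReal :=
  eintegral (μ.prod μ) (fun p => W (dist p.1 p.2))


section PairEnergy

/-- Fatou-type inequality for lower semicontinuous functions. -/
theorem lintegral_le_liminf_of_lowerSemicontinuous {Ω : Type*} [MeasurableSpace Ω]
    [TopologicalSpace Ω] [OpensMeasurableSpace Ω] [HasOuterApproxClosed Ω]
    {f : Ω → ℝ≥0∞} (hf : LowerSemicontinuous f) {μ : ProbabilityMeasure Ω}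
    {μs : ℕ → ProbabilityMeasure Ω} (h : Tendsto μs atTop (𝓝 μ)) :
    ∫⁻ x, f x ∂(μ : Measure Ω) ≤ atTop.liminf fun n ↦ ∫⁻ x, f x ∂(μs n : Measure Ω) := by
  have hopen : ∀ t : ℝ, IsOpen {x | ENNReal.ofReal t < f x} := fun t ↦ hf.isOpen_preimage _
  have hfm : Measurable f := hf.measurable
  have hm (M : ℕ) : Measurable fun x ↦ (min (f x) M).toReal :=
    (hfm.min measurable_const).ennreal_toReal
  have hval (M : ℕ) (x : Ω) : ENNReal.ofReal (min (f x) M).toReal = min (f x) M :=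
    ENNReal.ofReal_toReal (ne_top_of_le_ne_top (ENNReal.natCast_ne_top M) (min_le_right _ _))
  have key (M : ℕ) : ∫⁻ x, min (f x) M ∂(μ : Measure Ω) ≤
      atTop.liminf fun n ↦ ∫⁻ x, f x ∂(μs n : Measure Ω) := by
    have hG : ∀ t : ℝ, 0 < t → IsOpen {x | t < (min (f x) M).toReal} := by
      intro t ht
      have : {x | t < (min (f x) M).toReal} =
          {x | ENNReal.ofReal t < f x} ∩ {_x | ENNReal.ofReal t < M} := by
        ext x
        simp only [Set.mem_ofPred_eq, Set.mem_inter_iff, ← lt_min_iff]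
        rw [← hval M x, ENNReal.ofReal_lt_ofReal_iff_of_nonneg ht.le, hval]
      rw [this]
      exact (hopen t).inter isOpen_const
    have hlc (ν : Measure Ω) : ∫⁻ x, min (f x) M ∂ν =
        ∫⁻ t in Set.Ioi (0 : ℝ), ν {x | t < (min (f x) M).toReal} := by
      rw [← lintegral_eq_lintegral_meas_lt _ (Eventually.of_forall fun _ ↦ ENNReal.toReal_nonneg)
        (hm M).aemeasurable]
      simp_rw [hval]
    calc ∫⁻ x, min (f x) M ∂(μ : Measure Ω)
        = ∫⁻ t in Set.Ioi (0 : ℝ), (μ : Measure Ω) {x | t < (min (f x) M).toReal} := hlc _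
      _ ≤ ∫⁻ t in Set.Ioi (0 : ℝ),
            atTop.liminf fun n ↦ (μs n : Measure Ω) {x | t < (min (f x) M).toReal} :=
          setLIntegral_mono' measurableSet_Ioi fun t ht ↦
            ProbabilityMeasure.le_liminf_measure_open_of_tendsto h (hG t ht)
      _ ≤ atTop.liminf fun n ↦
            ∫⁻ t in Set.Ioi (0 : ℝ), (μs n : Measure Ω) {x | t < (min (f x) M).toReal} :=
          lintegral_liminf_le fun n ↦ Antitone.measurable fun s t hst ↦
            measure_mono fun ω hω ↦ lt_of_le_of_lt hst hω
      _ ≤ _ := by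
          refine liminf_le_liminf (Eventually.of_forall fun n ↦ ?_)
          rw [← hlc]
          exact lintegral_mono fun x ↦ min_le_left _ _
  have hsup (x : Ω) : f x = ⨆ M : ℕ, min (f x) M := by
    rw [← inf_iSup_eq, ENNReal.iSup_natCast, inf_top_eq]
  calc ∫⁻ x, f x ∂(μ : Measure Ω) = ∫⁻ x, ⨆ M : ℕ, min (f x) M ∂(μ : Measure Ω) :=
        lintegral_congr hsup
    _ = ⨆ M : ℕ, ∫⁻ x, min (f x) M ∂(μ : Measure Ω) :=
        lintegral_iSup (fun M ↦ hfm.min measurable_const) fun m n hmn x ↦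
          min_le_min le_rfl (by exact_mod_cast hmn)
    _ ≤ _ := iSup_le key

variable {E : Type*} [NormedAddCommGroup E] [MeasurableSpace E]

/-- The interaction energy of a measure for a nonnegative interaction potential. -/
noncomputable def pairEnergy (g : E → ℝ≥0∞) (μ : Measure E) : ℝ≥0∞ :=
  ∫⁻ p, g (p.1 - p.2) ∂(μ.prod μ)

theorem mul_measure_univ_sq_le_pairEnergy {g : E → ℝ≥0∞} {A : ℝ≥0∞}
    (hA : ∀ μ : ProbabilityMeasure E, A ≤ pairEnergy g (μ : Measure E))
    (ν : Measure E) [IsFiniteMeasure ν] :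
    A * (ν Set.univ * ν Set.univ) ≤ pairEnergy g ν := by
  rcases eq_or_ne ν 0 with rfl | hν
  · simp
  have h0 : ν Set.univ ≠ 0 := by simpa using hν
  have ht : ν Set.univ ≠ ⊤ := measure_ne_top ν _
  have : NeZero ν := ⟨hν⟩
  let P : ProbabilityMeasure E := ⟨(ν Set.univ)⁻¹ • ν, inferInstance⟩
  have hP : pairEnergy g (P : Measure E) =
      (ν Set.univ)⁻¹ * (ν Set.univ)⁻¹ * pairEnergy g ν := by
    simp only [pairEnergy, P, ProbabilityMeasure.coe_mk, Measure.prod_smul_left,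
      Measure.prod_smul_right, lintegral_smul_measure, smul_eq_mul, mul_assoc]
  calc A * (ν Set.univ * ν Set.univ)
      ≤ ((ν Set.univ)⁻¹ * (ν Set.univ)⁻¹ * pairEnergy g ν) * (ν Set.univ * ν Set.univ) := by
        gcongr; exact hP ▸ hA P
    _ = ((ν Set.univ)⁻¹ * ν Set.univ) * ((ν Set.univ)⁻¹ * ν Set.univ) * pairEnergy g ν := by ring
    _ = pairEnergy g ν := by rw [ENNReal.inv_mul_cancel h0 ht]; simp

variable [BorelSpace E] [SecondCountableTopology E]

theorem pairEnergy_map_sub {g : E → ℝ≥0∞} (hg : Measurable g) (μ : Measure E)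
    [IsProbabilityMeasure μ] (x : E) :
    pairEnergy g (μ.map (· - x)) = pairEnergy g μ := by
  have hx : Measurable fun y : E ↦ y - x := measurable_id.sub_const x
  rw [pairEnergy, Measure.map_prod_map _ _ hx hx, lintegral_map (by fun_prop) (by fun_prop)]
  simp [pairEnergy]

/-- If `μ` gives small mass to balls of radius `L`, its energy is almost the value at infinity. -/
theorem mul_one_sub_le_pairEnergy {g : E → ℝ≥0∞} (hg : Measurable g) {c δ : ℝ≥0∞} {L : ℝ}
    (hL : ∀ x, L ≤ ‖x‖ → c ≤ g x) (μ : Measure E) [IsProbabilityMeasure μ]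
    (h : ∀ x, μ (ball x L) ≤ δ) : c * (1 - δ) ≤ pairEnergy g μ := by
  rw [pairEnergy, lintegral_prod _ (by fun_prop)]
  have hin (x : E) : c * (1 - δ) ≤ ∫⁻ y, g (x - y) ∂μ := by
    calc c * (1 - δ) ≤ c * μ (ball x L)ᶜ := by
          rw [prob_compl_eq_one_sub measurableSet_ball]
          gcongr
          exact h x
      _ = ∫⁻ _ in (ball x L)ᶜ, c ∂μ := by simp
      _ ≤ ∫⁻ y in (ball x L)ᶜ, g (x - y) ∂μ := by
          refine setLIntegral_mono' measurableSet_ball.compl fun y hy ↦ hL _ ?_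
          rw [← dist_eq_norm, dist_comm]; simpa using hy
      _ ≤ ∫⁻ y, g (x - y) ∂μ := setLIntegral_le_lintegral _ _
  calc c * (1 - δ) = ∫⁻ _, c * (1 - δ) ∂μ := by simp
    _ ≤ _ := lintegral_mono hin

/-- Lower bound for the energy after splitting the mass into a ball and its complement. -/
theorem split_le_pairEnergy {g : E → ℝ≥0∞} {A c : ℝ≥0∞} {L : ℝ}
    (hL0 : 0 ≤ L) (hL : ∀ x, L ≤ ‖x‖ → c ≤ g x)
    (hA : ∀ μ : ProbabilityMeasure E, A ≤ pairEnergy g (μ : Measure E))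
    (μ : Measure E) [IsFiniteMeasure μ] (x : E) (r : ℝ) :
    A * (μ (ball x r) * μ (ball x r)) + A * (μ (ball x r)ᶜ * μ (ball x r)ᶜ) +
      2 * (c * (μ (ball x r) * μ (ball x (r + L))ᶜ)) ≤ pairEnergy g μ := by
  set B := ball x r
  set O := (ball x (r + L))ᶜ
  have hB : MeasurableSet B := measurableSet_ball
  have hO : MeasurableSet O := measurableSet_ball.compl
  have hOB : O ⊆ Bᶜ := Set.compl_subset_compl.2 (ball_subset_ball (by linarith))
  have hfar {y z : E} (hy : y ∈ B) (hz : z ∈ O) : L ≤ dist y z := by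
    simp only [B, O, mem_ball, Set.mem_compl_iff, not_lt] at hy hz
    linarith [dist_triangle z y x, dist_comm y z]
  let G : E × E → ℝ≥0∞ := fun p ↦ g (p.1 - p.2)
  have hdiag (S : Set E) : A * (μ S * μ S) ≤ ∫⁻ p in S ×ˢ S, G p ∂(μ.prod μ) := by
    have := mul_measure_univ_sq_le_pairEnergy hA (μ.restrict S)
    simpa [pairEnergy, Measure.prod_restrict] using this
  have hcross (S T : Set E) (hS : MeasurableSet S) (hT : MeasurableSet T)
      (hST : ∀ y ∈ S, ∀ z ∈ T, L ≤ dist y z) :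
      c * (μ S * μ T) ≤ ∫⁻ p in S ×ˢ T, G p ∂(μ.prod μ) := by
    calc c * (μ S * μ T) = ∫⁻ _ in S ×ˢ T, c ∂(μ.prod μ) := by simp
      _ ≤ _ := setLIntegral_mono' (hS.prod hT) fun p hp ↦ hL _ <| by
          rw [← dist_eq_norm]; exact hST _ hp.1 _ hp.2
  have d1 : Disjoint (B ×ˢ B) (Bᶜ ×ˢ Bᶜ) :=
    Set.disjoint_prod.2 (.inl disjoint_compl_right)
  have d2 : Disjoint (B ×ˢ B ∪ Bᶜ ×ˢ Bᶜ) (B ×ˢ O) := by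
    refine Set.disjoint_union_left.2 ⟨Set.disjoint_prod.2 (.inr ?_),
      Set.disjoint_prod.2 (.inl disjoint_compl_left)⟩
    exact disjoint_compl_right.mono_right hOB
  have d3 : Disjoint (B ×ˢ B ∪ Bᶜ ×ˢ Bᶜ ∪ B ×ˢ O) (O ×ˢ B) := by
    have hBO : Disjoint B O := disjoint_compl_right.mono_right hOB
    refine Set.disjoint_union_left.2 ⟨Set.disjoint_union_left.2
      ⟨Set.disjoint_prod.2 (.inl hBO), Set.disjoint_prod.2 (.inr disjoint_compl_left)⟩,
      Set.disjoint_prod.2 (.inl hBO)⟩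
  calc _ ≤ ∫⁻ p in B ×ˢ B, G p ∂(μ.prod μ) + ∫⁻ p in Bᶜ ×ˢ Bᶜ, G p ∂(μ.prod μ) +
        (∫⁻ p in B ×ˢ O, G p ∂(μ.prod μ) + ∫⁻ p in O ×ˢ B, G p ∂(μ.prod μ)) := by
        rw [two_mul]
        gcongr
        · exact hdiag B
        · exact hdiag Bᶜ
        · exact hcross B O hB hO fun y hy z hz ↦ hfar hy hz
        · rw [mul_comm (μ B)]
          exact hcross O B hO hB fun y hy z hz ↦ dist_comm z y ▸ hfar hz hy
    _ = ∫⁻ p in B ×ˢ B ∪ Bᶜ ×ˢ Bᶜ ∪ B ×ˢ O ∪ O ×ˢ B, G p ∂(μ.prod μ) := by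
        rw [lintegral_union (hO.prod hB) d3, lintegral_union (hB.prod hO) d2,
          lintegral_union (hB.compl.prod hB.compl) d1]
        simp only [add_assoc]
    _ ≤ _ := setLIntegral_le_lintegral _ _

/-- Quantitative tightness of almost minimizers. -/
theorem measureReal_compl_ball_mul_le {g : E → ℝ≥0∞} {A c : NNReal} {L δ η : ℝ}
    (hL0 : 0 ≤ L) (hL : ∀ x, L ≤ ‖x‖ → (c : ℝ≥0∞) ≤ g x) (hAc : A ≤ c)
    (hA : ∀ μ : ProbabilityMeasure E, (A : ℝ≥0∞) ≤ pairEnergy g (μ : Measure E))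
    (μ : Measure E) [IsProbabilityMeasure μ] (x : E)
    (hδ : δ ≤ μ.real (ball x L)) (hη : 0 ≤ η)
    (hμ : pairEnergy g μ ≤ A + ENNReal.ofReal η) {K : ℕ} (hK : 0 < K) :
    2 * ((c : ℝ) - A) * δ * μ.real (ball x (L + K * L))ᶜ ≤ η + 2 * c / K := by
  have hK' : (0 : ℝ) < K := by exact_mod_cast hK
  let a : ℕ → ℝ := fun k ↦ μ.real (ball x (L + k * L))
  have ha1 (k : ℕ) : a k ≤ 1 := measureReal_le_one
  have ha0 (k : ℕ) : 0 ≤ a k := measureReal_nonneg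
  have hmono : Monotone a := fun i j hij ↦ measureReal_mono (ball_subset_ball (by gcongr))
  obtain ⟨k, hk, hks⟩ : ∃ k ∈ Finset.range K, a (k + 1) - a k ≤ 1 / K := by
    refine Finset.exists_le_of_sum_le (by simpa using hK.ne') ?_
    rw [Finset.sum_range_sub]
    simp only [Finset.sum_const, Finset.card_range, nsmul_eq_mul]
    rw [mul_one_div_cancel hK'.ne']
    linarith [ha1 K, ha0 0]
  have hkK : k + 1 ≤ K := Finset.mem_range.1 hk
  have hsplit := (split_le_pairEnergy hL0 hL hA μ x (L + k * L)).trans hμ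
  have hcompl (s : ℝ) : μ.real (ball x s)ᶜ = 1 - μ.real (ball x s) :=
    probReal_compl_eq_one_sub measurableSet_ball
  have hr : L + k * L + L = L + (k + 1 : ℕ) * L := by push_cast; ring
  rw [hr] at hsplit
  have hreal : (A : ℝ) * (a k * a k) + A * ((1 - a k) * (1 - a k)) +
      2 * (c * (a k * (1 - a (k + 1)))) ≤ A + η := by
    have := ENNReal.toReal_mono (by finiteness) hsplit
    rw [ENNReal.toReal_add (by finiteness) (by finiteness),
      ENNReal.toReal_add (by finiteness) (by finiteness),
      ENNReal.toReal_add (by finiteness) (by finiteness)] at this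
    simp only [ENNReal.toReal_mul, ENNReal.coe_toReal, ENNReal.toReal_ofReal hη,
      ENNReal.toReal_ofNat] at this
    simp only [← measureReal_def, hcompl] at this
    exact this
  rw [hcompl]
  change 2 * ((c : ℝ) - A) * δ * (1 - a K) ≤ η + 2 * c / K
  have hδa : δ ≤ a k := hδ.trans (by simpa [a] using hmono (Nat.zero_le k))
  have hAc' : (0 : ℝ) ≤ c - A := sub_nonneg.2 (by exact_mod_cast hAc)
  have hc0 : (0 : ℝ) ≤ c := c.2
  have hak : a k ≤ a K := hmono (by omega)
  have h1 : 2 * ((c : ℝ) - A) * δ * (1 - a K) ≤ 2 * ((c : ℝ) - A) * (a k * (1 - a k)) := by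
    rw [mul_assoc (2 * ((c : ℝ) - A))]
    have : δ * (1 - a K) ≤ a k * (1 - a k) :=
      mul_le_mul hδa (by linarith) (by linarith [ha1 K]) (ha0 k)
    gcongr
  have h2 : 2 * c * (a k * (a (k + 1) - a k)) ≤ 2 * c / K := by
    have : a k * (a (k + 1) - a k) ≤ 1 * (1 / K) :=
      mul_le_mul (ha1 k) hks (sub_nonneg.2 (hmono (Nat.le_succ k))) zero_le_one
    calc 2 * c * (a k * (a (k + 1) - a k)) ≤ 2 * c * (1 * (1 / K)) := by gcongr
      _ = 2 * c / K := by ring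
  nlinarith [h1, h2, hreal]
/-- Existence of minimizers for nonnegative potentials whose value at infinity exceeds the energy
of some probability measure. -/
theorem exists_forall_pairEnergy_le [ProperSpace E] {g : E → ℝ≥0∞} (hg : LowerSemicontinuous g)
    {c : NNReal} {L : ℝ} (hL0 : 0 ≤ L) (hL : ∀ x, L ≤ ‖x‖ → (c : ℝ≥0∞) ≤ g x)
    (hc : ∃ μ : ProbabilityMeasure E, pairEnergy g (μ : Measure E) < c) :
    ∃ μ₀ : ProbabilityMeasure E, ∀ μ : ProbabilityMeasure E,
      pairEnergy g (μ₀ : Measure E) ≤ pairEnergy g (μ : Measure E) := by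
  have hgm : Measurable g := hg.measurable
  obtain ⟨A, hAinf⟩ : ∃ A : NNReal,
      (A : ℝ≥0∞) = ⨅ μ : ProbabilityMeasure E, pairEnergy g (μ : Measure E) := by
    obtain ⟨μ, hμ⟩ := hc
    exact ENNReal.canLift.prf _ ((iInf_le _ μ).trans_lt (hμ.trans ENNReal.coe_lt_top)).ne
  have hA (μ : ProbabilityMeasure E) : (A : ℝ≥0∞) ≤ pairEnergy g (μ : Measure E) :=
    hAinf ▸ iInf_le _ μ
  have hAc : A < c := by
    obtain ⟨μ, hμ⟩ := hc
    exact_mod_cast (hA μ).trans_lt hμ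
  obtain ⟨b, hAb, hbc⟩ := exists_between hAc
  obtain ⟨u, -, hu, hulim⟩ := exists_seq_strictAnti_tendsto' hAb
  have hc0 : (0 : ℝ) < c := by exact_mod_cast (zero_le : 0 ≤ A).trans_lt hAc
  let δ : ℝ := 1 - b / c
  have hδ0 : 0 < δ := sub_pos.2 ((div_lt_one hc0).2 (by exact_mod_cast hbc))
  have hδb : (c : ℝ≥0∞) * (1 - ENNReal.ofReal δ) = b := by
    have hbc0 : (0 : ℝ) ≤ b / c := by positivity
    rw [← ENNReal.ofReal_one, ← ENNReal.ofReal_sub _ hδ0.le, ← ENNReal.ofReal_coe_nnreal,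
      ← ENNReal.ofReal_mul hc0.le, ← ENNReal.ofReal_coe_nnreal]
    congr 1
    simp only [δ]
    field_simp
    ring
  have hex (n : ℕ) : ∃ ν : ProbabilityMeasure E, pairEnergy g (ν : Measure E) ≤ u n ∧
      δ ≤ (ν : Measure E).real (ball 0 L) := by
    obtain ⟨μ, hμ⟩ : ∃ μ : ProbabilityMeasure E, pairEnergy g (μ : Measure E) < u n := by
      rw [← iInf_lt_iff, ← hAinf]
      exact_mod_cast (hu n).1
    obtain ⟨x, hx⟩ : ∃ x, ENNReal.ofReal δ < (μ : Measure E) (ball x L) := by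
      by_contra! hcon
      have := mul_one_sub_le_pairEnergy hgm hL (μ : Measure E) hcon
      rw [hδb] at this
      exact absurd (this.trans_lt hμ) (not_lt.2 (by exact_mod_cast (hu n).2.le))
    have hm : Measurable fun y : E ↦ y - x := measurable_id.sub_const x
    refine ⟨μ.map hm.aemeasurable, ?_, ?_⟩
    · rw [ProbabilityMeasure.toMeasure_map, pairEnergy_map_sub hgm]
      exact hμ.le
    · rw [ProbabilityMeasure.toMeasure_map, map_measureReal_apply hm measurableSet_ball]
      have : (fun y : E ↦ y - x) ⁻¹' ball 0 L = ball x L := by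
        ext y; simp [dist_eq_norm]
      rw [this]
      exact (ENNReal.ofReal_le_iff_le_toReal (measure_ne_top _ _)).1 hx.le
  choose ν hνu hνδ using hex
  have htight : IsTightMeasureSet (Set.range fun n ↦ (ν n : Measure E)) := by
    refine isTightMeasureSet_range_of_tendsto_limsup_measure_norm_gt ?_
    rw [ENNReal.tendsto_nhds_zero]
    intro ε hε
    obtain ⟨e, he0, heε⟩ := ENNReal.lt_iff_exists_nnreal_btwn.1 hε
    have he0' : (0 : ℝ) < e := by exact_mod_cast he0
    have hcA : (0 : ℝ) < c - A := sub_pos.2 (by exact_mod_cast hAc)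
    let t : ℝ := (c - A) * δ * e
    have ht : 0 < t := by positivity
    obtain ⟨K, hK⟩ := exists_nat_gt (2 * c / t)
    have hK0 : (0 : ℝ) < K := lt_of_le_of_lt (by positivity) hK
    have hKt : 2 * (c : ℝ) / K ≤ t := by
      rw [div_lt_iff₀ ht] at hK
      rw [div_le_iff₀ hK0]
      linarith
    filter_upwards [eventually_ge_atTop (L + K * L)] with r hr
    refine limsup_le_of_le (by isBoundedDefault) ?_
    have hev : ∀ᶠ n in atTop, (u n : ℝ) < A + t :=
      (NNReal.tendsto_coe.2 hulim).eventually_lt_const (by linarith)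
    filter_upwards [hev] with n hn
    have hbound := measureReal_compl_ball_mul_le hL0 hL hAc.le hA (ν n : Measure E) 0
      (hνδ n) ht.le ((hνu n).trans (by
        rw [← ENNReal.ofReal_coe_nnreal, ← ENNReal.ofReal_coe_nnreal,
          ← ENNReal.ofReal_add A.coe_nonneg ht.le]
        exact ENNReal.ofReal_le_ofReal hn.le)) (by exact_mod_cast hK0 : 0 < K)
    have hfin : (ν n : Measure E).real (ball 0 (L + K * L))ᶜ ≤ e := by
      have h2 : 2 * ((c - A) * δ) * (ν n : Measure E).real (ball 0 (L + K * L))ᶜ ≤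
          2 * ((c - A) * δ) * e := by
        simp only [t] at hbound hKt
        linarith
      exact le_of_mul_le_mul_left h2 (by positivity)
    calc (ν n : Measure E) {x | r < ‖x‖} ≤ (ν n : Measure E) (ball 0 (L + K * L))ᶜ := by
          refine measure_mono fun x hx ↦ ?_
          have hx' : r < ‖x‖ := hx
          simp only [Set.mem_compl_iff, mem_ball, dist_zero_right, not_lt]
          linarith
      _ ≤ e := by
          rw [← ENNReal.ofReal_coe_nnreal]
          exact (ENNReal.le_ofReal_iff_toReal_le (measure_ne_top _ _) e.2).2 hfin
      _ ≤ ε := heε.le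
  have hcompact : IsCompact (closure (Set.range ν)) := by
    refine isCompact_closure_of_isTightMeasureSet ?_
    convert htight
    ext m
    simp
  obtain ⟨μ₀, -, φ, hφ, hlim⟩ :=
    hcompact.tendsto_subseq fun n ↦ subset_closure (Set.mem_range_self n)
  refine ⟨μ₀, fun μ ↦ le_trans ?_ (hA μ)⟩
  have hprod : Tendsto (fun n ↦ (ν (φ n)).prod (ν (φ n))) atTop (𝓝 (μ₀.prod μ₀)) :=
    (ProbabilityMeasure.continuous_prod.tendsto (μ₀, μ₀)).comp (hlim.prodMk_nhds hlim)
  have hlsc : LowerSemicontinuous fun p : E × E ↦ g (p.1 - p.2) :=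
    hg.comp (continuous_fst.sub continuous_snd)
  have hFlim : Tendsto (fun n ↦ pairEnergy g (ν (φ n) : Measure E)) atTop (𝓝 (A : ℝ≥0∞)) :=
    tendsto_of_tendsto_of_tendsto_of_le_of_le tendsto_const_nhds
      ((ENNReal.tendsto_coe.2 hulim).comp hφ.tendsto_atTop) (fun n ↦ hA _) fun n ↦ hνu _
  calc pairEnergy g (μ₀ : Measure E)
      ≤ atTop.liminf fun n ↦ pairEnergy g (ν (φ n) : Measure E) :=
        lintegral_le_liminf_of_lowerSemicontinuous hlsc hprod
    _ = A := hFlim.liminf_eq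

end PairEnergy

theorem EReal.toENNReal_add_coe_add_posPart_neg {v : EReal} {C : NNReal}
    (hv : -((C : ℝ) : EReal) ≤ v) :
    (v + ((C : ℝ) : EReal)).toENNReal + (-v).posPart = v.posPart + C := by
  induction v with
  | bot => exact absurd (le_bot_iff.1 hv) (by simp [← EReal.coe_neg])
  | top => simp [EReal.posPart]
  | coe r =>
    have hr : 0 ≤ r + C := by
      have : -(C : ℝ) ≤ r := by exact_mod_cast hv
      linarith
    have hC : (0 : ℝ) ≤ C := C.2
    rw [← EReal.coe_add, ← EReal.coe_neg, EReal.real_coe_toENNReal]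
    simp only [EReal.posPart, EReal.coe_ne_top, if_false, EReal.toReal_coe]
    rw [← ENNReal.ofReal_coe_nnreal]
    rcases le_total 0 r with h | h
    · rw [ENNReal.ofReal_of_nonpos (by linarith : -r ≤ 0), add_zero, ENNReal.ofReal_add h hC]
    · rw [ENNReal.ofReal_of_nonpos h, zero_add, ← ENNReal.ofReal_add hr (by linarith)]
      congr 1; ring

theorem EReal.posPart_neg_le {v : EReal} {C : NNReal} (hv : -((C : ℝ) : EReal) ≤ v) :
    (-v).posPart ≤ C := by
  have h : -v ≤ ((C : ℝ) : EReal) := EReal.neg_le.1 hv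
  have := EReal.toENNReal_le_toENNReal h
  rwa [EReal.real_coe_toENNReal, ENNReal.ofReal_coe_nnreal] at this

theorem EReal.coe_sub_coe_eq_of_add_eq_add {P Q F : ℝ≥0∞} {C : NNReal} (hQ : Q ≠ ⊤)
    (h : F + Q = P + C) : (P : EReal) - Q = F - ((C : ℝ) : EReal) := by
  lift Q to NNReal using hQ
  induction F with
  | top =>
    have hP : P = ⊤ := by
      by_contra hP
      exact (ENNReal.add_ne_top.2 ⟨hP, ENNReal.coe_ne_top⟩) (by rw [← h, top_add])
    subst hP
    rfl
  | coe f =>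
    have hP : P ≠ ⊤ := by
      rintro rfl
      rw [top_add] at h
      exact ENNReal.add_ne_top.2 ⟨ENNReal.coe_ne_top, ENNReal.coe_ne_top⟩ h
    lift P to NNReal using hP
    have h' : (f : ℝ) + Q = P + C := by exact_mod_cast h
    change ((P : ℝ) : EReal) - ((Q : ℝ) : EReal) = ((f : ℝ) : EReal) - ((C : ℝ) : EReal)
    rw [← EReal.coe_sub, ← EReal.coe_sub]
    congr 1
    linarith

variable {N : ℕ}

theorem energy_eq_pairEnergy_sub {W : ℝ → EReal}
    (hW : LowerSemicontinuous fun x : EuclideanSpace ℝ (Fin N) ↦ W ‖x‖) {C : NNReal}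
    (hC : ∀ x : EuclideanSpace ℝ (Fin N), -((C : ℝ) : EReal) ≤ W ‖x‖)
    (μ : ProbabilityMeasure (EuclideanSpace ℝ (Fin N))) :
    energy W (μ : Measure (EuclideanSpace ℝ (Fin N))) =
      pairEnergy (fun x ↦ (W ‖x‖ + ((C : ℝ) : EReal)).toENNReal)
        (μ : Measure (EuclideanSpace ℝ (Fin N))) - ((C : ℝ) : EReal) := by
  have hlb (p : EuclideanSpace ℝ (Fin N) × EuclideanSpace ℝ (Fin N)) :
      -((C : ℝ) : EReal) ≤ W ‖p.1 - p.2‖ := hC _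
  have hm : Measurable fun p : EuclideanSpace ℝ (Fin N) × EuclideanSpace ℝ (Fin N) ↦
      (-(W ‖p.1 - p.2‖)).posPart :=
    (hW.measurable.comp (measurable_fst.sub measurable_snd)).neg.ereal_toENNReal
  simp only [energy, eintegral, dist_eq_norm, pairEnergy]
  refine EReal.coe_sub_coe_eq_of_add_eq_add ?_ ?_
  · refine ne_top_of_le_ne_top (ENNReal.coe_ne_top (r := C)) ?_
    exact (lintegral_mono fun p ↦ EReal.posPart_neg_le (hlb p)).trans (by simp)
  · rw [← lintegral_add_right _ hm]
    simp_rw [EReal.toENNReal_add_coe_add_posPart_neg (hlb _)]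
    rw [lintegral_add_right _ measurable_const]
    simp

theorem exists_energy_eq_bot {W : ℝ → EReal} {x : EuclideanSpace ℝ (Fin N)} (hx : W ‖x‖ = ⊥) :
    ∃ μ : ProbabilityMeasure (EuclideanSpace ℝ (Fin N)),
      energy W (μ : Measure (EuclideanSpace ℝ (Fin N))) = ⊥ := by
  let ν : Measure (EuclideanSpace ℝ (Fin N)) := Measure.dirac 0 + Measure.dirac x
  let m : Measure (EuclideanSpace ℝ (Fin N)) := (ν Set.univ)⁻¹ • ν
  have hν : NeZero ν := ⟨by rw [← Measure.measure_univ_ne_zero]; simp [ν]⟩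
  have hm : IsProbabilityMeasure m := inferInstance
  have hpos {y : EuclideanSpace ℝ (Fin N)} (hy : ν {y} ≠ 0) : m {y} ≠ 0 := by
    simp only [m, Measure.smul_apply, smul_eq_mul]
    exact mul_ne_zero (ENNReal.inv_ne_zero.2 (measure_ne_top _ _)) hy
  have h0 : m {0} ≠ 0 := hpos (by simp [ν])
  have hx0 : m {x} ≠ 0 := hpos (by simp [ν])
  refine ⟨⟨m, hm⟩, ?_⟩
  have htop : ∫⁻ p, (-(W (dist p.1 p.2))).posPart ∂(m.prod m) = ⊤ := by
    refine top_unique ?_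
    calc (⊤ : ℝ≥0∞) = ∫⁻ p in {((0 : EuclideanSpace ℝ (Fin N)), x)},
          (-(W (dist p.1 p.2))).posPart ∂(m.prod m) := by
          rw [lintegral_singleton, dist_zero_left, hx, ← Set.singleton_prod_singleton,
            Measure.prod_prod, EReal.neg_bot]
          simp only [EReal.posPart, if_true]
          exact (ENNReal.top_mul (mul_ne_zero h0 hx0)).symm
      _ ≤ _ := setLIntegral_le_lintegral _ _
  simp only [energy, eintegral, ProbabilityMeasure.coe_mk, htop, EReal.coe_ennreal_top,
    EReal.sub_top]

/-- A lower semicontinuous potential with limit `0` at infinity which never takes the value `⊥`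
is bounded from below. -/
theorem exists_neg_coe_le_of_lowerSemicontinuous {W : ℝ → EReal}
    (hW : LowerSemicontinuous fun x : EuclideanSpace ℝ (Fin N) ↦ W ‖x‖)
    (hW_infty : Tendsto W atTop (𝓝 0))
    (hbot : ∀ x : EuclideanSpace ℝ (Fin N), W ‖x‖ ≠ ⊥) :
    ∃ C : NNReal, ∀ x : EuclideanSpace ℝ (Fin N), -((C : ℝ) : EReal) ≤ W ‖x‖ := by
  obtain ⟨R, hR⟩ := eventually_atTop.1
    (hW_infty.eventually_const_lt (show (-1 : EReal) < 0 by norm_num))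
  obtain ⟨x₀, -, hx₀⟩ := LowerSemicontinuousOn.exists_isMinOn
    (s := closedBall (0 : EuclideanSpace ℝ (Fin N)) |R|) ⟨0, by simp⟩
    (isCompact_closedBall _ _) (hW.lowerSemicontinuousOn _)
  obtain ⟨q, hq⟩ : ∃ q : ℝ, (q : EReal) < W ‖x₀‖ := by
    obtain ⟨q, -, hq⟩ := EReal.lt_iff_exists_real_btwn.1 (bot_lt_iff_ne_bot.2 (hbot x₀))
    exact ⟨q, hq⟩
  refine ⟨(max 1 (-q)).toNNReal, fun x ↦ ?_⟩
  rw [Real.coe_toNNReal _ (zero_le_one.trans (le_max_left 1 (-q))), ← EReal.coe_neg]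
  by_cases hx : ‖x‖ ≤ |R|
  · have h1 : W ‖x₀‖ ≤ W ‖x‖ := hx₀ (by simpa using hx)
    refine le_trans ?_ (hq.le.trans h1)
    exact EReal.coe_le_coe_iff.2 (by linarith [le_max_right 1 (-q)])
  · refine le_trans ?_ (hR ‖x‖ ((le_abs_self R).trans (not_le.1 hx).le)).le
    rw [← EReal.coe_one, ← EReal.coe_neg]
    exact EReal.coe_le_coe_iff.2 (by linarith [le_max_left 1 (-q)] : -max 1 (-q) ≤ -1)

/-- Existence of a global minimizer of the interaction energy for a lower semicontinuous,
locally integrable potential `W` with `W(r) → 0` as `r → ∞`, under the assumption (HE) that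
some probability measure has nonpositive energy. -/
theorem exists_minimizer_of_tendsto_zero {N : ℕ} (W : ℝ → EReal)
    (hW_lsc : LowerSemicontinuousOn W (Set.Ici 0))
    (hW_loc : ∀ K : Set (EuclideanSpace ℝ (Fin N)), IsCompact K →
      ∫⁻ x in K, (W ‖x‖).eabs ∂volume < ⊤)
    (hW_infty : Tendsto W atTop (𝓝 (0 : EReal)))
    (hHE : ∃ μb : ProbabilityMeasure (EuclideanSpace ℝ (Fin N)),
      energy W (μb : Measure (EuclideanSpace ℝ (Fin N))) ≤ 0) :
    ∃ μ₀ : ProbabilityMeasure (EuclideanSpace ℝ (Fin N)),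
      energy W (μ₀ : Measure (EuclideanSpace ℝ (Fin N))) =
        ⨅ μ : ProbabilityMeasure (EuclideanSpace ℝ (Fin N)),
          energy W (μ : Measure (EuclideanSpace ℝ (Fin N))) := by
  have hW : LowerSemicontinuous fun x : EuclideanSpace ℝ (Fin N) ↦ W ‖x‖ := by
    rw [← lowerSemicontinuousOn_univ_iff]
    exact hW_lsc.comp continuous_norm.continuousOn fun x _ ↦ norm_nonneg x
  by_cases hbot : ∃ x : EuclideanSpace ℝ (Fin N), W ‖x‖ = ⊥
  · obtain ⟨x, hx⟩ := hbot
    obtain ⟨μ, hμ⟩ := exists_energy_eq_bot hx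
    exact ⟨μ, le_antisymm (hμ ▸ bot_le) (iInf_le _ μ)⟩
  push Not at hbot
  obtain ⟨C, hC⟩ := exists_neg_coe_le_of_lowerSemicontinuous hW hW_infty hbot
  let g : EuclideanSpace ℝ (Fin N) → ℝ≥0∞ := fun x ↦ (W ‖x‖ + ((C : ℝ) : EReal)).toENNReal
  have henergy := energy_eq_pairEnergy_sub hW hC
  suffices h : ∃ μ₀ : ProbabilityMeasure (EuclideanSpace ℝ (Fin N)), ∀ μ :
      ProbabilityMeasure (EuclideanSpace ℝ (Fin N)),
      energy W (μ₀ : Measure (EuclideanSpace ℝ (Fin N))) ≤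
        energy W (μ : Measure (EuclideanSpace ℝ (Fin N))) by
    obtain ⟨μ₀, hμ₀⟩ := h
    exact ⟨μ₀, le_antisymm (le_iInf hμ₀) (iInf_le _ μ₀)⟩
  by_cases hneg : ∃ μ : ProbabilityMeasure (EuclideanSpace ℝ (Fin N)),
      energy W (μ : Measure (EuclideanSpace ℝ (Fin N))) < 0
  swap
  · push Not at hneg
    obtain ⟨μb, hμb⟩ := hHE
    exact ⟨μb, fun μ ↦ hμb.trans (hneg μ)⟩
  obtain ⟨μ₁, hμ₁⟩ := hneg
  have hlt : pairEnergy g (μ₁ : Measure (EuclideanSpace ℝ (Fin N))) < C := by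
    rw [henergy] at hμ₁
    by_contra! hle
    have h' : ((C : ℝ) : EReal) ≤ (pairEnergy g (μ₁ : Measure _) : EReal) :=
      EReal.coe_ennreal_le_coe_ennreal_iff.2 hle
    exact not_le.2 hμ₁ ((EReal.sub_nonneg (.inr (EReal.coe_ne_top _))
      (.inr (EReal.coe_ne_bot _))).2 h')
  obtain ⟨c, hμc, hcC⟩ := ENNReal.lt_iff_exists_nnreal_btwn.1 hlt
  have hcC' : (c : ℝ) - C < 0 := sub_neg.2 (by exact_mod_cast hcC)
  obtain ⟨L, hL⟩ := eventually_atTop.1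
    (hW_infty.eventually_const_lt (show (((c : ℝ) - C : ℝ) : EReal) < 0 by exact_mod_cast hcC'))
  have hg : LowerSemicontinuous g := by
    have hcont : Continuous fun a : EReal ↦ (a + ((C : ℝ) : EReal)).toENNReal := by
      refine EReal.continuous_toENNReal.comp (continuous_iff_continuousAt.2 fun a ↦ ?_)
      exact (EReal.continuousAt_add (.inr (EReal.coe_ne_bot _)) (.inr (EReal.coe_ne_top _))).comp
        (f := fun a : EReal ↦ (a, ((C : ℝ) : EReal))) (by fun_prop)
    exact hcont.comp_lowerSemicontinuous hW fun a b hab ↦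
      EReal.toENNReal_le_toENNReal (add_le_add_left hab _)
  obtain ⟨μ₀, hμ₀⟩ := exists_forall_pairEnergy_le hg (abs_nonneg L) (c := c) (fun x hx ↦ by
    have h1 := (hL ‖x‖ ((le_abs_self L).trans hx)).le
    have h2 : ((c : ℝ) : EReal) ≤ W ‖x‖ + ((C : ℝ) : EReal) := by
      calc ((c : ℝ) : EReal) = (((c : ℝ) - C : ℝ) : EReal) + ((C : ℝ) : EReal) := by
            rw [← EReal.coe_add, sub_add_cancel]
        _ ≤ _ := add_le_add_left h1 _
    simpa using EReal.toENNReal_le_toENNReal h2) ⟨μ₁, hμc⟩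
  refine ⟨μ₀, fun μ ↦ ?_⟩
  rw [henergy, henergy]
  exact EReal.sub_le_sub (by exact_mod_cast hμ₀ μ) le_rfl
end

section
/- Suppose W : [0,∞) → (-∞,∞] is lower-semicontinuous, bounded from below, and W(r) → 0 as r → ∞; let w(x) = W(|x|) on ℝ^N. If a sequence of probability measures {μ_k} on ℝ^N vanishes in Lions' sense, i.e. for every R > 0, lim_{k→∞} sup_{y ∈ ℝ^N} μ_k(B_R(y)) = 0, then liminf_{k→∞} E(μ_k) ≥ 0. -/
open MeasureTheory Metric Filter ENNReal Topology

lemma EReal.posPart_le_ofReal {a : EReal} {c : ℝ} (h : a ≤ c) :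
    a.posPart ≤ ENNReal.ofReal c := by
  induction a with
  | bot => simp [EReal.posPart]
  | top => simp at h
  | coe x =>
    simpa [EReal.posPart] using ENNReal.ofReal_le_ofReal (EReal.coe_le_coe_iff.1 h)

lemma neg_lintegral_posPart_neg_le_eintegral {α : Type*} [MeasurableSpace α] (μ : Measure α)
    (f : α → EReal) :
    -((∫⁻ x, (-(f x)).posPart ∂μ : ℝ≥0∞) : EReal) ≤ eintegral μ f := by
  rw [← zero_sub]
  exact EReal.sub_le_sub (EReal.coe_ennreal_nonneg _) le_rfl

/-- The mass that a product measure gives to a neighbourhood of the diagonal is controlled by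
the concentration function of the measure. -/
lemma prod_dist_lt_le_iSup_ball {X : Type*} [PseudoMetricSpace X] [SecondCountableTopology X]
    [MeasurableSpace X] [BorelSpace X] (μ : Measure X) [IsProbabilityMeasure μ] (R : ℝ) :
    (μ.prod μ) {p | dist p.1 p.2 < R} ≤ ⨆ y, μ (ball y R) := by
  have hmeas : MeasurableSet {p : X × X | dist p.1 p.2 < R} :=
    (isOpen_lt continuous_dist continuous_const).measurableSet
  rw [Measure.prod_apply hmeas]
  calc ∫⁻ x, μ (Prod.mk x ⁻¹' {p : X × X | dist p.1 p.2 < R}) ∂μ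
      ≤ ∫⁻ _, ⨆ y, μ (ball y R) ∂μ := by
        refine lintegral_mono fun x => le_iSup_of_le x (measure_mono fun z hz => ?_)
        simpa [dist_comm] using hz
    _ = ⨆ y, μ (ball y R) := by simp

lemma lintegral_posPart_neg_le {X : Type*} [PseudoMetricSpace X] [SecondCountableTopology X]
    [MeasurableSpace X] [BorelSpace X] (μ : Measure X) [IsProbabilityMeasure μ]
    {W : ℝ → EReal} {C δ R : ℝ} (hC : ∀ r : ℝ, 0 ≤ r → (C : EReal) ≤ W r)
    (hR : ∀ r : ℝ, R ≤ r → ((-δ : ℝ) : EReal) ≤ W r) :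
    ∫⁻ p, (-(W (dist p.1 p.2))).posPart ∂(μ.prod μ)
      ≤ ENNReal.ofReal δ + ENNReal.ofReal (-C) * ⨆ y, μ (ball y R) := by
  have hmeas : MeasurableSet {p : X × X | dist p.1 p.2 < R} :=
    (isOpen_lt continuous_dist continuous_const).measurableSet
  calc ∫⁻ p, (-(W (dist p.1 p.2))).posPart ∂(μ.prod μ)
      ≤ ∫⁻ p, (ENNReal.ofReal δ +
          {p : X × X | dist p.1 p.2 < R}.indicator (fun _ => ENNReal.ofReal (-C)) p)
          ∂(μ.prod μ) := by
        refine lintegral_mono fun p => ?_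
        by_cases hp : dist p.1 p.2 < R
        · rw [Set.indicator_of_mem (by exact hp)]
          refine le_add_left (EReal.posPart_le_ofReal ?_)
          rw [EReal.coe_neg]
          exact EReal.neg_le_neg_iff.2 (hC _ dist_nonneg)
        · refine le_add_right (EReal.posPart_le_ofReal ?_)
          simpa using EReal.neg_le_neg_iff.2 (hR _ (not_lt.1 hp))
    _ = ENNReal.ofReal δ +
          ENNReal.ofReal (-C) * (μ.prod μ) {p : X × X | dist p.1 p.2 < R} := by
        rw [lintegral_add_left measurable_const, lintegral_indicator_const hmeas]
        simp
    _ ≤ _ := by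
        gcongr
        exact prod_dist_lt_le_iSup_ball μ R

/-- For a lower semicontinuous potential bounded from below with `W(r) → 0` as `r → ∞`, the
energies of a vanishing (in Lions' sense) sequence of probability measures satisfy
`liminf E(μ_k) ≥ 0`. -/
theorem liminf_energy_nonneg_of_vanishing {N : ℕ} (W : ℝ → EReal)
    (hW_lsc : LowerSemicontinuousOn W (Set.Ici 0))
    (hW_bdd : ∃ C : ℝ, ∀ r : ℝ, 0 ≤ r → (C : EReal) ≤ W r)
    (hW_infty : Tendsto W atTop (𝓝 (0 : EReal)))
    (μs : ℕ → Measure (EuclideanSpace ℝ (Fin N)))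
    (hprob : ∀ k, IsProbabilityMeasure (μs k))
    (hvanish : ∀ R : ℝ, 0 < R →
      Tendsto (fun k => ⨆ y : EuclideanSpace ℝ (Fin N), μs k (ball y R)) atTop (𝓝 0)) :
    (0 : EReal) ≤ atTop.liminf (fun k => energy W (μs k)) := by
  obtain ⟨C, hC⟩ := hW_bdd
  have hneg : Tendsto (fun k => ∫⁻ p, (-(W (dist p.1 p.2))).posPart ∂((μs k).prod (μs k)))
      atTop (𝓝 0) := by
    refine ENNReal.tendsto_nhds_zero.2 fun ε hε => ?_
    obtain ⟨δ, hδ, hδε⟩ := ENNReal.lt_iff_exists_nnreal_btwn.1 (ENNReal.half_pos hε.ne')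
    have hδ' : ((-(δ : ℝ) : ℝ) : EReal) < 0 := by
      exact_mod_cast neg_lt_zero.2 (NNReal.coe_pos.2 (ENNReal.coe_pos.1 hδ))
    obtain ⟨R, hR⟩ := eventually_atTop.1 (hW_infty.eventually_const_lt hδ')
    have hlim := ENNReal.Tendsto.const_mul (a := ENNReal.ofReal (-C))
      (hvanish (max R 1) (by positivity)) (Or.inr ENNReal.ofReal_ne_top)
    rw [mul_zero] at hlim
    filter_upwards [ENNReal.tendsto_nhds_zero.1 hlim _ (ENNReal.half_pos hε.ne')] with k hk
    have := hprob k
    calc _ ≤ _ := lintegral_posPart_neg_le (μs k) hC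
            fun r hr => (hR r ((le_max_left R 1).trans hr)).le
      _ ≤ ε / 2 + ε / 2 := by
        gcongr
        simpa using hδε.le
      _ = ε := ENNReal.add_halves ε
  have hlim : Tendsto (fun k => -((∫⁻ p, (-(W (dist p.1 p.2))).posPart
      ∂((μs k).prod (μs k)) : ℝ≥0∞) : EReal)) atTop (𝓝 0) := by
    simpa using ((continuous_coe_ennreal_ereal.tendsto 0).comp hneg).neg
  rw [← hlim.liminf_eq]
  exact liminf_le_liminf
    (Eventually.of_forall fun k => neg_lintegral_posPart_neg_le_eintegral _ _)
end

section
/- Suppose W : [0,∞) → (-∞,∞] is lower-semicontinuous, w(x) = W(|x|) is locally integrable on ℝ^N, and W(r) → 0 as r → ∞. If w is absolutely integrable on ℝ^N and ∫_{ℝ^N} W(|x|) dx < 0, then there exists a probability measure μ̄ ∈ P(ℝ^N) with E(μ̄) ≤ 0 (in fact one can take μ̄ with density (1/(ω_N (nR)^N)) χ_{B_{nR}(0)} for suitable R > 0 and n large, which satisfies E(μ̄) < 0). -/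
open MeasureTheory Metric Filter ENNReal Topology

/-- The uniform probability measure on the ball of radius `R` centered at the origin. -/
noncomputable def unifBall (N : ℕ) (R : ℝ) : Measure (EuclideanSpace ℝ (Fin N)) :=
  (volume (ball (0 : EuclideanSpace ℝ (Fin N)) R))⁻¹ •
    volume.restrict (ball (0 : EuclideanSpace ℝ (Fin N)) R)

lemma EReal.measurable_posPart : Measurable EReal.posPart := by
  unfold EReal.posPart
  exact Measurable.ite (measurableSet_singleton _) measurable_const
    measurable_ereal_toReal.ennreal_ofReal

lemma measurable_comp_norm_of_lowerSemicontinuousOn {E : Type*} [NormedAddCommGroup E]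
    [MeasurableSpace E] [BorelSpace E] {W : ℝ → EReal}
    (hW : LowerSemicontinuousOn W (Set.Ici 0)) : Measurable (fun x : E => W ‖x‖) := by
  refine LowerSemicontinuous.measurable fun x c hc => ?_
  have h := hW ‖x‖ (norm_nonneg x) c hc
  have ht : Tendsto (fun y : E => ‖y‖) (𝓝 x) (𝓝[Set.Ici 0] ‖x‖) :=
    tendsto_nhdsWithin_iff.2
      ⟨continuous_norm.continuousAt, Eventually.of_forall fun y => norm_nonneg y⟩
  exact ht.eventually h

/-- Integrals over an increasing sequence of balls exhaust the integral over the whole space. -/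
lemma exists_nat_lt_setLIntegral_ball {E : Type*} [NormedAddCommGroup E]
    [MeasurableSpace E] [BorelSpace E] (μ : Measure E) (f : E → ℝ≥0∞) {a : ℝ≥0∞}
    (ha : a < ∫⁻ x, f x ∂μ) : ∃ m : ℕ, a < ∫⁻ x in ball (0 : E) m, f x ∂μ := by
  have hdir : Monotone (fun m : ℕ => ball (0 : E) (m : ℝ)) := fun i j hij =>
    ball_subset_ball (by exact_mod_cast hij)
  have h := setLIntegral_iUnion_of_directed (μ := μ) f hdir.directed_le
  rw [iUnion_ball_nat, setLIntegral_univ] at h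
  rw [h] at ha
  exact lt_iSup_iff.1 ha

lemma isProbabilityMeasure_unifBall (N : ℕ) {R : ℝ} (hR : 0 < R) :
    IsProbabilityMeasure (unifBall N R) := by
  constructor
  rw [unifBall, Measure.smul_apply, Measure.restrict_apply_univ, smul_eq_mul]
  exact ENNReal.inv_mul_cancel (measure_ball_pos _ _ hR).ne' measure_ball_lt_top.ne

/-- The average of a translation-invariant kernel against the uniform measure on a ball is at most
its total integral divided by the volume of the ball. -/
lemma lintegral_prod_unifBall_le {N : ℕ} {R : ℝ} (hR : 0 < R)
    {f : EuclideanSpace ℝ (Fin N) → ℝ≥0∞} (hf : Measurable f) :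
    ∫⁻ p, f (p.1 - p.2) ∂((unifBall N R).prod (unifBall N R)) ≤
      (volume (ball (0 : EuclideanSpace ℝ (Fin N)) R))⁻¹ * ∫⁻ x, f x := by
  have := isProbabilityMeasure_unifBall N hR
  rw [lintegral_prod _ (by fun_prop)]
  calc ∫⁻ x, ∫⁻ y, f (x - y) ∂(unifBall N R) ∂(unifBall N R)
      ≤ ∫⁻ _, ((volume (ball (0 : EuclideanSpace ℝ (Fin N)) R))⁻¹ * ∫⁻ x, f x) ∂(unifBall N R) := by
        refine lintegral_mono fun x => ?_
        rw [unifBall, lintegral_smul_measure, smul_eq_mul]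
        rw [← lintegral_sub_left_eq_self f x]
        exact mul_le_mul_right (setLIntegral_le_lintegral _ _) _
    _ = _ := by simp

/-- Lower bound for the average of a translation-invariant kernel against the uniform measure on a
ball, obtained by discarding a boundary layer of width `m`. -/
lemma le_lintegral_prod_unifBall {N : ℕ} {R : ℝ} (hR : 0 < R) (m : ℝ)
    {f : EuclideanSpace ℝ (Fin N) → ℝ≥0∞} (hf : Measurable f) :
    (volume (ball (0 : EuclideanSpace ℝ (Fin N)) R))⁻¹ *
      ((volume (ball (0 : EuclideanSpace ℝ (Fin N)) R))⁻¹ *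
        volume (ball (0 : EuclideanSpace ℝ (Fin N)) (R - m)) *
        ∫⁻ x in ball (0 : EuclideanSpace ℝ (Fin N)) m, f x) ≤
      ∫⁻ p, f (p.1 - p.2) ∂((unifBall N R).prod (unifBall N R)) := by
  have := isProbabilityMeasure_unifBall N hR
  rcases le_or_gt m 0 with hm | hm
  · simp [ball_eq_empty.2 hm]
  rw [lintegral_prod _ (by fun_prop)]
  set V := volume (ball (0 : EuclideanSpace ℝ (Fin N)) R)
  set b := ∫⁻ x in ball (0 : EuclideanSpace ℝ (Fin N)) m, f x with hb
  have hsub : ball (0 : EuclideanSpace ℝ (Fin N)) (R - m) ⊆ ball 0 R :=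
    ball_subset_ball (by linarith)
  have key : ∀ x ∈ ball (0 : EuclideanSpace ℝ (Fin N)) (R - m),
      V⁻¹ * b ≤ ∫⁻ y, f (x - y) ∂(unifBall N R) := by
    intro x hx
    rw [unifBall, lintegral_smul_measure, smul_eq_mul]
    gcongr
    rw [hb, ← lintegral_indicator measurableSet_ball, ← lintegral_indicator measurableSet_ball,
      ← lintegral_sub_left_eq_self _ x]
    refine lintegral_mono fun y => ?_
    by_cases hy : x - y ∈ ball (0 : EuclideanSpace ℝ (Fin N)) m
    · have hyR : y ∈ ball (0 : EuclideanSpace ℝ (Fin N)) R := by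
        rw [mem_ball_zero_iff] at *
        have := norm_sub_le x (x - y)
        rw [show x - (x - y) = y by abel] at this
        linarith
      simp [Set.indicator_of_mem hy, Set.indicator_of_mem hyR]
    · simp [Set.indicator_of_notMem hy]
  calc V⁻¹ * (V⁻¹ * volume (ball (0 : EuclideanSpace ℝ (Fin N)) (R - m)) * b)
      = ∫⁻ _ in ball (0 : EuclideanSpace ℝ (Fin N)) (R - m), V⁻¹ * b ∂(unifBall N R) := by
        rw [setLIntegral_const, unifBall, Measure.smul_apply,
          Measure.restrict_apply measurableSet_ball, Set.inter_eq_left.2 hsub, smul_eq_mul]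
        ring
    _ ≤ ∫⁻ x in ball (0 : EuclideanSpace ℝ (Fin N)) (R - m),
          ∫⁻ y, f (x - y) ∂(unifBall N R) ∂(unifBall N R) :=
        setLIntegral_mono' measurableSet_ball key
    _ ≤ _ := setLIntegral_le_lintegral _ _

/-- Removing a boundary layer of fixed width from a large ball does not change its volume
asymptotically. -/
lemma tendsto_volume_ball_sub_div (N m : ℕ) :
    Tendsto (fun n : ℕ => (volume (ball (0 : EuclideanSpace ℝ (Fin N)) (n : ℝ)))⁻¹ *
      volume (ball (0 : EuclideanSpace ℝ (Fin N)) ((n : ℝ) - m))) atTop (𝓝 1) := by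
  have hlim : Tendsto (fun n : ℕ => ENNReal.ofReal ((((n : ℝ) - m) / n) ^ N)) atTop (𝓝 1) := by
    have h1 : Tendsto (fun n : ℕ => 1 - (m : ℝ) / n) atTop (𝓝 (1 - 0)) :=
      tendsto_const_nhds.sub (tendsto_const_div_atTop_nhds_zero_nat _)
    have h2 : Tendsto (fun n : ℕ => ((n : ℝ) - m) / n) atTop (𝓝 1) := by
      rw [sub_zero] at h1
      refine h1.congr' ?_
      filter_upwards [eventually_gt_atTop 0] with n hn
      have : (n : ℝ) ≠ 0 := by positivity
      field_simp
    simpa using ENNReal.tendsto_ofReal (h2.pow N)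
  refine hlim.congr' ?_
  filter_upwards [eventually_gt_atTop m] with n hn
  have hn0 : (0 : ℝ) < n := by exact_mod_cast (Nat.zero_le m).trans_lt hn
  have hnm : (0 : ℝ) < (n : ℝ) - m := sub_pos.2 (by exact_mod_cast hn)
  have hdim : Module.finrank ℝ (EuclideanSpace ℝ (Fin N)) = N := by simp
  rw [Measure.addHaar_ball_of_pos _ _ hn0, Measure.addHaar_ball_of_pos _ _ hnm, hdim, div_pow,
    ENNReal.ofReal_div_of_pos (by positivity),
    ENNReal.mul_inv (Or.inr measure_ball_lt_top.ne)
      (Or.inr (measure_ball_pos volume _ one_pos).ne'), div_eq_mul_inv]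
  set v := volume (ball (0 : EuclideanSpace ℝ (Fin N)) 1)
  have hvv : v⁻¹ * v = 1 :=
    ENNReal.inv_mul_cancel (measure_ball_pos _ _ one_pos).ne' measure_ball_lt_top.ne
  calc _ = (ENNReal.ofReal ((n : ℝ) - m) ^ N * (ENNReal.ofReal (n : ℝ) ^ N)⁻¹) * (v⁻¹ * v) := by
        rw [hvv, mul_one, ENNReal.ofReal_pow hnm.le, ENNReal.ofReal_pow hn0.le]
    _ = _ := by
        rw [ENNReal.ofReal_pow hnm.le, ENNReal.ofReal_pow hn0.le]
        ring

/-- If `w(x) = W(|x|)` is absolutely integrable on `ℝ^N` with `∫ W(|x|) dx < 0` (and `W` is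
lower semicontinuous, locally integrable, vanishing at infinity), then condition (HE) holds:
some probability measure has nonpositive energy; in fact uniform measures on large balls
`B_{nR}(0)` have negative energy. -/
theorem condition_HE_of_negative_integral {N : ℕ} (W : ℝ → EReal)
    (hW_lsc : LowerSemicontinuousOn W (Set.Ici 0))
    (hW_loc : ∀ K : Set (EuclideanSpace ℝ (Fin N)), IsCompact K →
      ∫⁻ x in K, (W ‖x‖).eabs ∂volume < ⊤)
    (hW_infty : Tendsto W atTop (𝓝 (0 : EReal)))
    (hW_int : ∫⁻ x : EuclideanSpace ℝ (Fin N), (W ‖x‖).eabs ∂volume < ⊤)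
    (hW_neg : eintegral volume (fun x : EuclideanSpace ℝ (Fin N) => W ‖x‖) < 0) :
    (∃ μb : ProbabilityMeasure (EuclideanSpace ℝ (Fin N)),
      energy W (μb : Measure (EuclideanSpace ℝ (Fin N))) ≤ 0) ∧
    (∃ R : ℝ, 0 < R ∧ ∃ n₀ : ℕ, ∀ n : ℕ, n₀ ≤ n →
      energy W (unifBall N (n * R)) < 0) := by
  have hmeas : Measurable (fun x : EuclideanSpace ℝ (Fin N) => W ‖x‖) :=
    measurable_comp_norm_of_lowerSemicontinuousOn hW_lsc
  set f : EuclideanSpace ℝ (Fin N) → ℝ≥0∞ := fun x => (W ‖x‖).posPart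
  set g : EuclideanSpace ℝ (Fin N) → ℝ≥0∞ := fun x => (-(W ‖x‖)).posPart
  have hf : Measurable f := EReal.measurable_posPart.comp hmeas
  have hg : Measurable g := EReal.measurable_posPart.comp hmeas.neg
  have hf_fin : ∫⁻ x, f x ≠ ⊤ :=
    ((lintegral_mono fun x => (le_self_add : f x ≤ f x + g x)).trans_lt hW_int).ne
  have hfg : ∫⁻ x, f x < ∫⁻ x, g x := by
    by_contra! h
    refine absurd hW_neg (not_lt.2 ?_)
    exact (EReal.sub_nonneg (Or.inl (by simpa using hf_fin)) (by simp)).2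
      (EReal.coe_ennreal_le_coe_ennreal_iff.2 h)
  obtain ⟨m, hm⟩ := exists_nat_lt_setLIntegral_ball volume g hfg
  set b := ∫⁻ x in ball (0 : EuclideanSpace ℝ (Fin N)) (m : ℝ), g x
  have hb_lim := ENNReal.Tendsto.mul_const (b := b) (tendsto_volume_ball_sub_div N m)
    (Or.inl one_ne_zero)
  rw [one_mul] at hb_lim
  obtain ⟨n₀, hn₀⟩ := eventually_atTop.1 ((hb_lim.eventually_const_lt hm).and
    (eventually_gt_atTop 0))
  have main : ∀ n : ℕ, n₀ ≤ n → energy W (unifBall N n) < 0 := by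
    intro n hn
    obtain ⟨hlt, hpos⟩ := hn₀ n hn
    have hn0 : (0 : ℝ) < n := by exact_mod_cast hpos
    have hV0 : (volume (ball (0 : EuclideanSpace ℝ (Fin N)) (n : ℝ)))⁻¹ ≠ 0 :=
      ENNReal.inv_ne_zero.2 measure_ball_lt_top.ne
    have hVt : (volume (ball (0 : EuclideanSpace ℝ (Fin N)) (n : ℝ)))⁻¹ ≠ ⊤ :=
      ENNReal.inv_ne_top.2 (measure_ball_pos _ _ hn0).ne'
    have hlt' := (lintegral_prod_unifBall_le hn0 hf).trans_lt
      ((ENNReal.mul_lt_mul_right hV0 hVt hlt).trans_le (le_lintegral_prod_unifBall hn0 m hg))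
    simp only [energy, eintegral, dist_eq_norm]
    rw [EReal.sub_neg (by left; simpa using hlt'.ne_top) (by simp)]
    exact EReal.coe_ennreal_lt_coe_ennreal_iff.2 hlt'
  refine ⟨?_, 1, one_pos, n₀, fun n hn => by simpa using main n hn⟩
  have hn0 : (0 : ℝ) < n₀ := by exact_mod_cast (hn₀ n₀ le_rfl).2
  exact ⟨⟨unifBall N n₀, isProbabilityMeasure_unifBall N hn0⟩, (main n₀ le_rfl).le⟩
end
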